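/- For any real M ≥ 2 and any real t, ψ(t) = −Σ_{1 ≤ |m| ≤ M} e(mt)/(2πim) + O( min(1, 1/(M‖t‖)) ), where the sum is over nonzero integers m with |m| ≤ M and the implied constant is absolute. -/

import Mathlib

/-- `nint x` is the distance from the real number `x` to the nearest integer. -/
noncomputable def nint (x : ℝ) : ℝ := |x - round x|

/-- `e2pi x = e^{2πix}`. -/
noncomputable def e2pi (x : ℝ) : ℂ := Complex.exp (2 * Real.pi * Complex.I * x)

/-- `psi t = {t} - 1/2`. -/
noncomputable def psi (t : ℝ) : ℝ := Int.fract t - 1 / 2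

/-- The partial sum `∑_{m = 1}^{N} sin (2πmt) / (πm)` of the Fourier series of the sawtooth. -/
noncomputable def sawtoothSum (N : ℕ) (t : ℝ) : ℝ :=
  ∑ m ∈ Finset.range N, Real.sin (2 * Real.pi * (m + 1) * t) / (Real.pi * (m + 1))

theorem sin_mul_dirichletKernel (N : ℕ) (x : ℝ) :
    Real.sin x * (1 + ∑ m ∈ Finset.range N, 2 * Real.cos (2 * (m + 1) * x)) =
      Real.sin ((2 * N + 1) * x) := by
  induction N with
  | zero => simp
  | succ n ih =>
    rw [Finset.sum_range_succ, ← add_assoc, mul_add, ih]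
    have h1 : (2 * (n : ℝ) + 1) * x = 2 * (n + 1) * x - x := by ring
    have h2 : (2 * ((n + 1 : ℕ) : ℝ) + 1) * x = 2 * (n + 1) * x + x := by push_cast; ring
    rw [h1, h2, Real.sin_add, Real.sin_sub]
    ring

theorem hasDerivAt_sawtoothSum (N : ℕ) (t : ℝ) :
    HasDerivAt (sawtoothSum N)
      (∑ m ∈ Finset.range N, 2 * Real.cos (2 * (m + 1) * (Real.pi * t))) t := by
  unfold sawtoothSum
  refine HasDerivAt.fun_sum fun m _ => ?_
  have h := (((hasDerivAt_id t).const_mul (2 * Real.pi * ((m : ℝ) + 1))).sin).div_const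
    (Real.pi * (m + 1))
  refine h.congr_deriv ?_
  have : (m : ℝ) + 1 ≠ 0 := by positivity
  have e : 2 * Real.pi * ((m : ℝ) + 1) * id t = 2 * (m + 1) * (Real.pi * t) := by
    simp only [id]; ring
  rw [e]
  field_simp

theorem sawtoothSum_half (N : ℕ) : sawtoothSum N (1 / 2) = 0 := by
  refine Finset.sum_eq_zero fun m _ => ?_
  have e : 2 * Real.pi * ((m : ℝ) + 1) * (1 / 2) = ((m + 1 : ℕ) : ℝ) * Real.pi := by
    push_cast; ring
  rw [e, Real.sin_nat_mul_pi, zero_div]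

theorem sawtoothSum_neg (N : ℕ) (t : ℝ) : sawtoothSum N (-t) = -sawtoothSum N t := by
  simp [sawtoothSum, neg_div]

theorem sawtoothSum_sub_intCast (N : ℕ) (t : ℝ) (k : ℤ) :
    sawtoothSum N (t - k) = sawtoothSum N t := by
  refine Finset.sum_congr rfl fun m _ => ?_
  have e : 2 * Real.pi * ((m : ℝ) + 1) * (t - k) =
      2 * Real.pi * (m + 1) * t - (((m + 1) * k : ℤ) : ℝ) * (2 * Real.pi) := by
    push_cast; ring
  rw [e, Real.sin_sub_int_mul_two_pi]

theorem abs_sawtoothSum_le (N : ℕ) {t : ℝ} (ht : 0 ≤ t) : |sawtoothSum N t| ≤ 2 * (N * t) := by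
  refine (Finset.abs_sum_le_sum_abs _ _).trans ?_
  have h : ∀ m ∈ Finset.range N,
      |Real.sin (2 * Real.pi * ((m : ℝ) + 1) * t) / (Real.pi * (m + 1))| ≤ 2 * t := by
    intro m _
    have hp : 0 < Real.pi * ((m : ℝ) + 1) := by positivity
    rw [abs_div, abs_of_pos hp, div_le_iff₀ hp]
    refine Real.abs_sin_le_abs.trans ?_
    rw [abs_of_nonneg (by positivity)]
    exact le_of_eq (by ring)
  refine (Finset.sum_le_sum h).trans (le_of_eq ?_)
  simp
  ring

theorem mul_sawtooth_add_sum_ge (N : ℕ) {ε t : ℝ} (hε : |ε| ≤ 1) (ht : 0 < t) (ht' : t ≤ 1 / 2) :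
    -(2 / ((2 * N + 1) * Real.pi * Real.sin (Real.pi * t))) ≤
      ε * (t - 1 / 2 + sawtoothSum N t) := by
  set L : ℝ := (2 * N + 1) * Real.pi with hL
  have hpi := Real.pi_pos
  have hLpos : 0 < L := by positivity
  have habs : ∀ u : ℝ, |ε * Real.cos u| ≤ 1 := fun u => by
    rw [abs_mul]
    exact mul_le_one₀ hε (abs_nonneg _) (Real.abs_cos_le_one _)
  have hs : ∀ u ∈ Set.Icc t (1 / 2), 0 < Real.sin (Real.pi * u) := fun u hu =>
    Real.sin_pos_of_pos_of_lt_pi (mul_pos hpi (ht.trans_le hu.1)) (by nlinarith [hu.2])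
  let K : ℝ → ℝ := fun u =>
    ε * (u - 1 / 2 + sawtoothSum N u + Real.cos (L * u) / (L * Real.sin (Real.pi * u))) +
      1 / (L * Real.sin (Real.pi * u))
  have hK : ∀ u ∈ Set.Icc t (1 / 2), HasDerivAt K
      (-(Real.pi * Real.cos (Real.pi * u) / (L * Real.sin (Real.pi * u) ^ 2)) *
        (ε * Real.cos (L * u) + 1)) u := by
    intro u hu
    have hsu := (hs u hu).ne'
    have hlin : ∀ c : ℝ, HasDerivAt (fun v : ℝ => c * v) c u := fun c => by
      simpa using (hasDerivAt_id u).const_mul c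
    have hsin := ((hlin Real.pi).sin).const_mul L
    have hne : L * Real.sin (Real.pi * u) ≠ 0 := mul_ne_zero hLpos.ne' hsu
    have h := (((((hasDerivAt_id u).sub_const (1 / 2)).add (hasDerivAt_sawtoothSum N u)).add
      (((hlin L).cos).div hsin hne)).const_mul ε).add ((hasDerivAt_const u (1 : ℝ)).div hsin hne)
    refine h.congr_deriv ?_
    have hD : 1 + ∑ m ∈ Finset.range N, 2 * Real.cos (2 * ((m : ℝ) + 1) * (Real.pi * u)) =
        Real.sin (L * u) / Real.sin (Real.pi * u) := by
      rw [eq_div_iff hsu, mul_comm, sin_mul_dirichletKernel, hL, mul_assoc]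
    rw [hD]
    field_simp
    ring
  have hanti : AntitoneOn K (Set.Icc t (1 / 2)) := by
    refine antitoneOn_of_deriv_nonpos (convex_Icc _ _)
      (fun u hu => (hK u hu).continuousAt.continuousWithinAt)
      (fun u hu => (hK u (interior_subset hu)).differentiableAt.differentiableWithinAt)
      fun u hu => ?_
    have hu' := interior_subset hu
    rw [(hK u hu').deriv]
    have hsu := hs u hu'
    have hc : 0 ≤ Real.cos (Real.pi * u) :=
      Real.cos_nonneg_of_neg_pi_div_two_le_of_le (by nlinarith [hu'.1]) (by nlinarith [hu'.2])
    have h1 : 0 ≤ ε * Real.cos (L * u) + 1 := by linarith [neg_le_of_abs_le (habs (L * u))]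
    rw [neg_mul]
    exact neg_nonpos.2 (by positivity)
  have hle := hanti (Set.left_mem_Icc.2 ht') (Set.right_mem_Icc.2 ht') ht'
  have hcos : Real.cos (L * (1 / 2)) = 0 := by
    rw [Real.cos_eq_zero_iff]
    exact ⟨N, by rw [hL]; push_cast; ring⟩
  have hst := hs t (Set.left_mem_Icc.2 ht')
  have hhalf : 0 ≤ K (1 / 2) := by
    have := hs (1 / 2) (Set.right_mem_Icc.2 ht')
    simp only [K, sawtoothSum_half, hcos]
    simp only [sub_self, zero_div, add_zero, mul_zero, zero_add]
    positivity
  have hKt : K t = ε * (t - 1 / 2 + sawtoothSum N t) +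
      (ε * Real.cos (L * t) + 1) / (L * Real.sin (Real.pi * t)) := by
    simp only [K]
    ring
  have hq : (ε * Real.cos (L * t) + 1) / (L * Real.sin (Real.pi * t)) ≤
      2 / (L * Real.sin (Real.pi * t)) := by
    gcongr
    linarith [le_of_abs_le (habs (L * t))]
  linarith

theorem abs_sawtooth_add_sum_le (N : ℕ) {t : ℝ} (ht : 0 < t) (ht' : t ≤ 1 / 2) :
    |t - 1 / 2 + sawtoothSum N t| ≤ 1 / ((2 * N + 1) * t) := by
  have h1 := mul_sawtooth_add_sum_ge N (ε := 1) (by simp) ht ht'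
  have h2 := mul_sawtooth_add_sum_ge N (ε := -1) (by simp) ht ht'
  have hpi := Real.pi_gt_three
  have hsin : 2 * t ≤ Real.sin (Real.pi * t) := by
    have := Real.mul_le_sin (x := Real.pi * t) (by positivity) (by nlinarith)
    refine le_trans (le_of_eq ?_) this
    field_simp
  have hb : 2 / ((2 * N + 1) * Real.pi * Real.sin (Real.pi * t)) ≤ 1 / ((2 * N + 1) * t) := by
    have hs : 0 < Real.sin (Real.pi * t) := by linarith
    rw [div_le_div_iff₀ (by positivity) (by positivity)]
    have : 2 * t ≤ Real.pi * Real.sin (Real.pi * t) := by nlinarith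
    have hN : (0 : ℝ) ≤ 2 * N + 1 := by positivity
    nlinarith [mul_le_mul_of_nonneg_left this hN]
  rw [abs_le]
  constructor <;> linarith

theorem abs_psi_add_sawtoothSum (N : ℕ) {t : ℝ} (ht : nint t ≠ 0) :
    |psi t + sawtoothSum N t| = |nint t - 1 / 2 + sawtoothSum N (nint t)| := by
  have hr := abs_sub_round t
  have hper := sawtoothSum_sub_intCast N t (round t)
  have hfract : Int.fract (t - round t) = Int.fract t := Int.fract_sub_intCast t (round t)
  unfold nint at *
  unfold psi
  rw [← hper, ← hfract]
  generalize t - (round t : ℝ) = s at *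
  have hs0 : s ≠ 0 := abs_ne_zero.1 ht
  rcases lt_or_gt_of_ne hs0 with hneg | hpos
  · rw [abs_of_neg hneg] at hr ⊢
    have : Int.fract s = s + 1 := by
      rw [Int.fract_eq_iff]
      exact ⟨by linarith, by linarith, -1, by push_cast; ring⟩
    rw [this, sawtoothSum_neg, ← abs_neg]
    congr 1
    ring
  · rw [abs_of_pos hpos] at hr ⊢
    rw [Int.fract_eq_self.2 ⟨hpos.le, by linarith⟩]

theorem sum_Icc_neg_erase_zero (N : ℕ) (f : ℤ → ℂ) :
    ∑ m ∈ (Finset.Icc (-(N : ℤ)) N).erase 0, f m =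
      ∑ m ∈ Finset.range N, (f (m + 1) + f (-(m + 1))) := by
  induction N with
  | zero => simp
  | succ n ih =>
    have h : (Finset.Icc (-((n + 1 : ℕ) : ℤ)) ((n + 1 : ℕ) : ℤ)).erase 0 =
        insert ((n : ℤ) + 1) (insert (-((n : ℤ) + 1)) ((Finset.Icc (-(n : ℤ)) n).erase 0)) := by
      ext m
      simp only [Finset.mem_erase, Finset.mem_Icc, Finset.mem_insert]
      push_cast
      omega
    have h1 : -((n : ℤ) + 1) ∉ (Finset.Icc (-(n : ℤ)) n).erase 0 := by
      simp only [Finset.mem_erase, Finset.mem_Icc]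
      omega
    have h2 : (n : ℤ) + 1 ∉ insert (-((n : ℤ) + 1)) ((Finset.Icc (-(n : ℤ)) n).erase 0) := by
      simp only [Finset.mem_erase, Finset.mem_Icc, Finset.mem_insert]
      omega
    rw [h, Finset.sum_insert h2, Finset.sum_insert h1, ih, Finset.sum_range_succ]
    ring

theorem sum_e2pi_eq_sawtoothSum (N : ℕ) (t : ℝ) :
    ∑ m ∈ (Finset.Icc (-(N : ℤ)) N).erase 0,
      e2pi ((m : ℝ) * t) / (2 * Real.pi * Complex.I * (m : ℂ)) = (sawtoothSum N t : ℂ) := by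
  rw [sum_Icc_neg_erase_zero, sawtoothSum, Complex.ofReal_sum]
  refine Finset.sum_congr rfl fun m _ => ?_
  have hm : (m : ℂ) + 1 ≠ 0 := by exact_mod_cast Nat.succ_ne_zero m
  have hpi : (Real.pi : ℂ) ≠ 0 := by exact_mod_cast Real.pi_ne_zero
  unfold e2pi
  push_cast
  rw [Complex.sin]
  have e1 : 2 * (Real.pi : ℂ) * Complex.I * (((m : ℂ) + 1) * t) =
      2 * Real.pi * (m + 1) * t * Complex.I := by ring
  have e2 : 2 * (Real.pi : ℂ) * Complex.I * (-((m : ℂ) + 1) * t) =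
      -(2 * Real.pi * (m + 1) * t) * Complex.I := by ring
  rw [e1, e2]
  generalize Complex.exp (2 * Real.pi * (m + 1) * t * Complex.I) = a
  generalize Complex.exp (-(2 * Real.pi * (m + 1) * t) * Complex.I) = b
  have hm' : -((m : ℂ) + 1) = (-1) * (m + 1) := by ring
  have hI : (Complex.I)⁻¹ = -Complex.I := Complex.inv_I
  rw [hm']
  simp only [div_eq_mul_inv, mul_inv, hI]
  ring

theorem psi_fourier_expansion :
    ∃ C > 0, ∀ (M t : ℝ), 2 ≤ M →
      ‖((psi t : ℝ) : ℂ) +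
          ∑ m ∈ (Finset.Icc (-⌊M⌋) ⌊M⌋).erase 0,
            e2pi ((m : ℝ) * t) / (2 * Real.pi * Complex.I * (m : ℂ))‖ ≤
        C * (if nint t = 0 then (1 : ℝ) else min 1 (1 / (M * nint t))) := by
  refine ⟨3, by norm_num, fun M t hM => ?_⟩
  have hM0 : 0 ≤ M := by linarith
  rw [← Int.natCast_floor_eq_floor hM0, sum_e2pi_eq_sawtoothSum, ← Complex.ofReal_add,
    Complex.norm_real, Real.norm_eq_abs]
  have hN := Nat.floor_le hM0
  have hN' := Nat.lt_floor_add_one M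
  generalize ⌊M⌋₊ = N at *
  split_ifs with h
  · have hz : t - (round t : ℝ) = 0 := abs_eq_zero.1 h
    have hsum : sawtoothSum N t = 0 := by
      rw [← sawtoothSum_sub_intCast N t (round t), hz]
      simp [sawtoothSum]
    have h0 := Int.fract_nonneg t
    have h1 := Int.fract_lt_one t
    rw [hsum, psi, abs_le]
    constructor <;> linarith
  · rw [abs_psi_add_sawtoothSum N h]
    have hle : nint t ≤ 1 / 2 := abs_sub_round t
    have hpos : 0 < nint t := lt_of_le_of_ne (abs_nonneg _) (Ne.symm h)
    generalize nint t = s at *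
    have hMs : 0 < M * s := by positivity
    rcases le_total (M * s) 1 with h1 | h1
    · rw [min_eq_left ((one_le_div hMs).2 h1)]
      have hB := abs_le.1 (abs_sawtoothSum_le N hpos.le)
      have hNs : N * s ≤ 1 := (mul_le_mul_of_nonneg_right hN hpos.le).trans h1
      rw [abs_le]
      constructor <;> linarith [hB.1, hB.2]
    · rw [min_eq_right ((div_le_one hMs).2 h1)]
      have hb : 1 / ((2 * (N : ℝ) + 1) * s) ≤ 1 / (M * s) := by
        gcongr
        have : (0 : ℝ) ≤ N := N.cast_nonneg
        linarith
      have : 0 < 1 / (M * s) := by positivity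
      linarith [abs_sawtooth_add_sum_le N hpos hle]
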